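/- If A is the pure common lines matrix associated to rotations R⁽¹⁾,…,R⁽ⁿ⁾ ∈ SO(3), and Q ∈ SO(3), then the pure common lines matrix associated to R⁽¹⁾Q,…,R⁽ⁿ⁾Q equals A. That is, the map ψ : SO(3)ⁿ → ℝ^{2n×n} sending rotations to their pure common lines matrix is invariant under the diagonal right-multiplication action of SO(3). -/

import Mathlib

open Matrix

/-- The pure common lines matrix of rotations `R⁽¹⁾,…,R⁽ⁿ⁾`. -/
def pureCLM {n : ℕ} (R : Fin n → Matrix (Fin 3) (Fin 3) ℝ) :
    Matrix (Fin n × Fin 2) (Fin n) ℝ :=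
  Matrix.of fun p j =>
    if p.1 = j then 0
    else (R p.1) p.2.castSucc ⬝ᵥ (crossProduct ((R p.1) 2) ((R j) 2))

/-- The map `ψ` sending rotations to their pure common lines matrix is invariant
under the diagonal right-multiplication action of `SO(3)`:
`ψ(R⁽¹⁾Q,…,R⁽ⁿ⁾Q) = ψ(R⁽¹⁾,…,R⁽ⁿ⁾)`. -/
theorem stmt6 {n : ℕ} (R : Fin n → Matrix (Fin 3) (Fin 3) ℝ)
    (hR : ∀ i, R i ∈ Matrix.specialOrthogonalGroup (Fin 3) ℝ)
    (Q : Matrix (Fin 3) (Fin 3) ℝ)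
    (hQ : Q ∈ Matrix.specialOrthogonalGroup (Fin 3) ℝ) :
    pureCLM (fun i => R i * Q) = pureCLM R := by
  have hd : Q.det = 1 := (Matrix.mem_specialOrthogonalGroup_iff.mp hQ).2
  ext p j
  simp only [pureCLM, Matrix.of_apply]
  split_ifs with h
  · rfl
  · rw [triple_product_eq_det, triple_product_eq_det]
    have key : Matrix.of ![(R p.1 * Q) p.2.castSucc, (R p.1 * Q) 2, (R j * Q) 2]
        = Matrix.of ![(R p.1) p.2.castSucc, (R p.1) 2, (R j) 2] * Q := by
      ext a b
      fin_cases a <;> simp [Matrix.mul_apply]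
    have h2 := congrArg Matrix.det key
    rw [Matrix.det_mul, hd, mul_one] at h2
    exact h2
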